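/- arXiv:1805.09174 — 2 statements merged into one kernel-verified Lean document; each statement's English description precedes it below -/
import Mathlib

section
/- There is a universal constant C > 0 with the following property. Fix integers d, T ≥ 1 and a real G ≥ 1 with (4G/3)·T² ≥ e^e, and let Θ₀ ⊂ B₁ be a finite set which is a (1/T²)-cover of B₁ in ℓ¹-norm, i.e. for every θ ∈ B₁ there is θ' ∈ Θ₀ with ‖θ − θ'‖₁ ≤ 1/T². Let ℓ₁,…,ℓ_T satisfy (A1) and (A2, deterministic form) with constants α > 0 and β ∈ (0,1]. Run the Squint/BOA algorithm with the elements of Θ₀ as the points θ₁,…,θ_K, the uniform initial probability vector, and parameter E = 4G/3, producing predictions θ̂₀,…,θ̂_{T−1}. Then for every θ ∈ B₁: (1/T) Σ_{t=1}^T (ℓ_t(θ̂_{t−1}) − ℓ_t(θ)) ≤ C ((log Card(Θ₀) + log log(GT) + 1)/(α T))^{1/(2−β)} + C (log Card(Θ₀) + log log(GT) + 1) G / T + G/T². -/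
open Finset

/-- ℓ¹-norm on `Fin d → ℝ`. -/
noncomputable def l1 {d : ℕ} (x : Fin d → ℝ) : ℝ := ∑ i, |x i|

/-- Euclidean dot product. -/
noncomputable def dotp {d : ℕ} (x y : Fin d → ℝ) : ℝ := ∑ i, x i * y i

/-- Gradient of `f` at `θ` (coordinates of the Fréchet derivative). -/
noncomputable def grad {d : ℕ} (f : (Fin d → ℝ) → ℝ) (θ : Fin d → ℝ) : Fin d → ℝ :=
  fun i => fderiv ℝ f θ (Pi.single i 1)

/-- The Squint/BOA weight update: given parameter `E`, number of learning rates `M`,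
initial weights `π0` and linearized regrets `r`, the weight of expert `k` after
observing rounds `1,…,t`.  The learning rates are `η i = (e^i E)⁻¹`, `i = 1,…,M`. -/
noncomputable def boaWeight {K : ℕ} (E : ℝ) (M : ℕ) (π0 : Fin K → ℝ)
    (r : ℕ → Fin K → ℝ) (t : ℕ) (k : Fin K) : ℝ :=
  (∑ i ∈ Finset.Icc 1 M, (Real.exp i * E)⁻¹ *
      Real.exp ((Real.exp i * E)⁻¹ * ∑ s ∈ Finset.Icc 1 t,
        (r s k - (Real.exp i * E)⁻¹ * (r s k) ^ 2)) * π0 k) /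
  (∑ i ∈ Finset.Icc 1 M, ∑ j, π0 j * (Real.exp i * E)⁻¹ *
      Real.exp ((Real.exp i * E)⁻¹ * ∑ s ∈ Finset.Icc 1 t,
        (r s j - (Real.exp i * E)⁻¹ * (r s j) ^ 2)))

theorem exp_sub_sq_le_one_add {x : ℝ} (hx : -(14 / 25) ≤ x) : Real.exp (x - x ^ 2) ≤ 1 + x := by
  rcases le_or_gt 0 x with h | h
  · have h1 := Real.add_one_le_exp (-(x - x ^ 2))
    have h2 : Real.exp (x - x ^ 2) * Real.exp (-(x - x ^ 2)) = 1 := by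
      rw [← Real.exp_add]; simp
    have h3 : 0 < Real.exp (x - x ^ 2) := Real.exp_pos _
    have h4 : Real.exp (x - x ^ 2) * (-(x - x ^ 2) + 1) ≤ 1 := by
      nlinarith
    have h5 : 1 ≤ (1 + x) * (-(x - x ^ 2) + 1) := by nlinarith [pow_nonneg h 3]
    have h6 : 0 < -(x - x ^ 2) + 1 := by nlinarith [sq_nonneg (x - 1 / 2)]
    exact le_of_mul_le_mul_right (h4.trans h5) h6
  · obtain ⟨u, rfl⟩ : ∃ u, x = -u := ⟨-x, by ring⟩
    have hu : 0 < u := by linarith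
    have hu' : u ≤ 14 / 25 := by linarith
    have hz : 0 ≤ u + u ^ 2 := by positivity
    have h1 := Real.sum_le_exp_of_nonneg hz 4
    simp only [Finset.sum_range_succ, Finset.sum_range_zero, Nat.factorial] at h1
    norm_num at h1
    have h2 : Real.exp (-u - (-u) ^ 2) * Real.exp (u + u ^ 2) = 1 := by
      rw [← Real.exp_add]; ring_nf; simp
    have h3 : 1 ≤ (1 + -u) * Real.exp (u + u ^ 2) := by
      have h4 : (1 + -u) * (1 + (u + u ^ 2) + (u + u ^ 2) ^ 2 / 2 + (u + u ^ 2) ^ 3 / 6)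
          ≤ (1 + -u) * Real.exp (u + u ^ 2) := by
        apply mul_le_mul_of_nonneg_left h1; linarith
      have p2 : u ^ 2 ≤ (14 / 25) ^ 2 := by gcongr
      have p3 : u ^ 3 ≤ (14 / 25) ^ 3 := by gcongr
      have p4 : u ^ 4 ≤ (14 / 25) ^ 4 := by gcongr
      have p5 : u ^ 5 ≤ (14 / 25) ^ 5 := by gcongr
      have h5 : 0 ≤ u ^ 2 * (1 / 2 - u / 3 - u ^ 2 / 6 - u ^ 3 / 2 - u ^ 4 / 3 - u ^ 5 / 6) := by
        apply mul_nonneg (by positivity)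
        norm_num at p2 p3 p4 p5
        linarith
      nlinarith
    exact le_of_mul_le_mul_right (h2.le.trans h3) (Real.exp_pos _)

/-- The Squint potential does not increase when the weighted linearized regrets vanish. -/
theorem squint_potential_le {K : ℕ} (I : Finset ℕ) (η : ℕ → ℝ) (r : ℕ → Fin K → ℝ) (T : ℕ)
    (hr : ∀ t, 1 ≤ t → t ≤ T → ∀ i ∈ I, ∀ k, -(14 / 25) ≤ η i * r t k)
    (hw : ∀ t, t < T → ∑ k, (∑ i ∈ I, η i *
      Real.exp (η i * ∑ s ∈ Finset.Icc 1 t, (r s k - η i * (r s k) ^ 2))) * r (t + 1) k = 0) :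
    ∑ i ∈ I, ∑ k, Real.exp (η i * ∑ s ∈ Finset.Icc 1 T, (r s k - η i * (r s k) ^ 2))
      ≤ I.card * K := by
  induction T with
  | zero => simp
  | succ n ih =>
    refine le_trans ?_ (ih (fun t h1 h2 => hr t h1 (by omega)) (fun t h => hw t (by omega)))
    have key : ∑ i ∈ I, ∑ k,
        Real.exp (η i * ∑ s ∈ Finset.Icc 1 (n + 1), (r s k - η i * (r s k) ^ 2))
        ≤ ∑ i ∈ I, ∑ k, (Real.exp (η i * ∑ s ∈ Finset.Icc 1 n, (r s k - η i * (r s k) ^ 2))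
          + η i * Real.exp (η i * ∑ s ∈ Finset.Icc 1 n, (r s k - η i * (r s k) ^ 2))
            * r (n + 1) k) := by
      refine Finset.sum_le_sum fun i hi => Finset.sum_le_sum fun k _ => ?_
      rw [Finset.sum_Icc_succ_top (by omega), mul_add, Real.exp_add]
      have h1 := exp_sub_sq_le_one_add (hr (n + 1) (by omega) le_rfl i hi k)
      have h2 : η i * (r (n + 1) k - η i * r (n + 1) k ^ 2)
          = η i * r (n + 1) k - (η i * r (n + 1) k) ^ 2 := by ring
      rw [h2]
      refine (mul_le_mul_of_nonneg_left h1 (Real.exp_pos _).le).trans (le_of_eq ?_)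
      ring
    refine key.trans (le_of_eq ?_)
    simp only [Finset.sum_add_distrib]
    have h0 := hw n (by omega)
    simp only [Finset.sum_mul] at h0
    rw [Finset.sum_comm] at h0
    rw [h0, add_zero]

theorem squint_regret_le {K : ℕ} (M : ℕ) (η : ℕ → ℝ) (r : ℕ → Fin K → ℝ) (T : ℕ)
    (hr : ∀ t, 1 ≤ t → t ≤ T → ∀ i ∈ Finset.Icc 1 M, ∀ k, -(14 / 25) ≤ η i * r t k)
    (hw : ∀ t, t < T → ∑ k, (∑ i ∈ Finset.Icc 1 M, η i *
      Real.exp (η i * ∑ s ∈ Finset.Icc 1 t, (r s k - η i * (r s k) ^ 2))) * r (t + 1) k = 0)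
    (i : ℕ) (hi : i ∈ Finset.Icc 1 M) (k : Fin K) :
    η i * ∑ s ∈ Finset.Icc 1 T, (r s k - η i * (r s k) ^ 2) ≤ Real.log M + Real.log K := by
  have hM : 0 < M := by rw [Finset.mem_Icc] at hi; omega
  have hK : 0 < K := Fin.pos k
  have h := squint_potential_le _ η r T hr hw
  rw [← Real.log_mul (by positivity) (by positivity), Real.le_log_iff_exp_le (by positivity)]
  simp only [Nat.card_Icc, Nat.add_sub_cancel] at h
  refine le_trans ?_ h
  refine le_trans ?_ (Finset.single_le_sum
    (f := fun i => ∑ k, Real.exp (η i * ∑ s ∈ Finset.Icc 1 T, (r s k - η i * (r s k) ^ 2)))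
    (fun i _ => Finset.sum_nonneg fun k _ => (Real.exp_pos _).le) hi)
  exact Finset.single_le_sum
    (f := fun k => Real.exp (η i * ∑ s ∈ Finset.Icc 1 T, (r s k - η i * (r s k) ^ 2)))
    (fun k _ => (Real.exp_pos _).le) (Finset.mem_univ k)

theorem abs_dotp_le {d : ℕ} {g : Fin d → ℝ} {G : ℝ} (hg : ∀ i, |g i| ≤ G) (x : Fin d → ℝ) :
    |dotp g x| ≤ G * l1 x := by
  unfold dotp l1
  rw [Finset.mul_sum]
  refine (Finset.abs_sum_le_sum_abs _ _).trans (Finset.sum_le_sum fun i _ => ?_)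
  rw [abs_mul]
  exact mul_le_mul_of_nonneg_right (hg i) (abs_nonneg _)

theorem l1_sub_le {d : ℕ} (x y : Fin d → ℝ) : l1 (x - y) ≤ l1 x + l1 y := by
  unfold l1
  rw [← Finset.sum_add_distrib]
  exact Finset.sum_le_sum fun i _ => abs_sub _ _

theorem l1_sub_comm {d : ℕ} (x y : Fin d → ℝ) : l1 (x - y) = l1 (y - x) := by
  unfold l1
  exact Finset.sum_congr rfl fun i _ => abs_sub_comm _ _

theorem l1_sum_smul_le_one {d K : ℕ} {p : Fin K → ℝ} {x : Fin K → Fin d → ℝ} (hp : ∀ k, 0 ≤ p k)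
    (hs : ∑ k, p k = 1) (hx : ∀ k, l1 (x k) ≤ 1) : l1 (∑ k, p k • x k) ≤ 1 := by
  calc l1 (∑ k, p k • x k) ≤ ∑ i, ∑ k, p k * |x k i| := by
        unfold l1
        refine Finset.sum_le_sum fun i _ => ?_
        rw [Finset.sum_apply]
        refine (Finset.abs_sum_le_sum_abs _ _).trans (Finset.sum_le_sum fun k _ => ?_)
        rw [Pi.smul_apply, smul_eq_mul, abs_mul, abs_of_nonneg (hp k)]
    _ = ∑ k, p k * l1 (x k) := by
        rw [Finset.sum_comm]
        simp only [l1, Finset.mul_sum]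
    _ ≤ ∑ k, p k * 1 :=
        Finset.sum_le_sum fun k _ => mul_le_mul_of_nonneg_left (hx k) (hp k)
    _ = 1 := by simpa using hs

/-- The linearized regrets average to zero under the weights of the prediction. -/
theorem sum_mul_dotp_sub_eq_zero {d K : ℕ} {p : Fin K → ℝ} (hs : ∑ k, p k = 1)
    (g : Fin d → ℝ) (x : Fin K → Fin d → ℝ) :
    ∑ k, p k * dotp g ((∑ j, p j • x j) - x k) = 0 := by
  simp only [dotp, Finset.mul_sum]
  rw [Finset.sum_comm]
  refine Finset.sum_eq_zero fun i _ => ?_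
  have h : ∀ k, p k * (g i * ((∑ j, p j • x j) - x k) i)
      = g i * (p k * (∑ j, p j • x j) i - p k * x k i) := fun k => by
    rw [Pi.sub_apply]; ring
  simp only [h]
  rw [← Finset.mul_sum, Finset.sum_sub_distrib, ← Finset.sum_mul, hs, Finset.sum_apply]
  simp

theorem boaWeight_uniform {K : ℕ} (hK : 1 ≤ K) (E : ℝ) (M : ℕ) (r : ℕ → Fin K → ℝ) (t : ℕ)
    (k : Fin K) :
    boaWeight E M (fun _ => 1 / (K : ℝ)) r t k =
      (∑ i ∈ Finset.Icc 1 M, (Real.exp i * E)⁻¹ * Real.exp ((Real.exp i * E)⁻¹ *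
        ∑ s ∈ Finset.Icc 1 t, (r s k - (Real.exp i * E)⁻¹ * (r s k) ^ 2))) /
      ∑ j, ∑ i ∈ Finset.Icc 1 M, (Real.exp i * E)⁻¹ * Real.exp ((Real.exp i * E)⁻¹ *
        ∑ s ∈ Finset.Icc 1 t, (r s j - (Real.exp i * E)⁻¹ * (r s j) ^ 2)) := by
  have hK' : (K : ℝ) ≠ 0 := by positivity
  unfold boaWeight
  rw [← Finset.sum_mul, Finset.sum_comm]
  simp only [mul_assoc, ← Finset.mul_sum]
  rw [mul_comm, mul_div_mul_left _ _ (by positivity)]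

/-- Among geometrically decreasing learning rates, one matches a target rate up to a factor `e`,
unless the target is out of range. -/
theorem exists_rate_near {E h : ℝ} (hE : 0 < E) {M : ℕ} (hM : 1 ≤ M) :
    (Real.exp (1 : ℕ) * E)⁻¹ ≤ h ∨ h < (Real.exp M * E)⁻¹ ∨
      ∃ i ∈ Finset.Icc 1 M, (Real.exp (i : ℕ) * E)⁻¹ ≤ h ∧
        h ≤ Real.exp 1 * (Real.exp (i : ℕ) * E)⁻¹ := by
  induction M, hM using Nat.le_induction with
  | base => exact (le_or_gt _ _).imp_right Or.inl
  | succ n hn ih =>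
    rcases ih with ih | ih | ⟨i, hi, ih⟩
    · exact Or.inl ih
    · refine Or.inr ((lt_or_ge h (Real.exp ((n + 1 : ℕ) : ℝ) * E)⁻¹).imp_right fun h1 =>
        ⟨n + 1, by simp, h1, ih.le.trans (le_of_eq ?_)⟩)
      push_cast
      rw [Real.exp_add]
      field_simp
    · exact Or.inr (Or.inr ⟨i, Finset.Icc_subset_Icc_right (Nat.le_succ n) hi, ih⟩)

theorem rpow_one_sub_mul_le {ε x β : ℝ} (hε : 0 ≤ ε) (hx : 0 ≤ x) (hβ : 0 < β) (hβ1 : β ≤ 1) :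
    ε ^ (1 - β) * x ≤ x ^ (1 / β) + ε := by
  have h := Real.geom_mean_le_arith_mean2_weighted (by linarith : 0 ≤ 1 - β) hβ.le hε
    (Real.rpow_nonneg hx (1 / β)) (by ring)
  rw [← Real.rpow_mul hx, one_div_mul_cancel hβ.ne', Real.rpow_one] at h
  have h1 := Real.rpow_nonneg hx (1 / β)
  nlinarith [mul_nonneg hβ.le hε, mul_nonneg (by linarith : 0 ≤ 1 - β) h1]

/-- Tuning of the learning rate under the weak exp-concavity correction. -/
theorem exists_rate_tradeoff_le {T M : ℕ} (hT : 1 ≤ T) (hM : 1 ≤ M) {G α β Λ : ℝ} (hG : 1 ≤ G)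
    (hα : 0 < α) (hβ : 0 < β) (hβ1 : β ≤ 1) (hΛ : 1 ≤ Λ)
    (hMT : (4 * G / 3) * (T : ℝ) ^ 2 ≤ Real.exp M) (x : ℕ → ℝ)
    (hx : ∀ t, 1 ≤ t → t ≤ T → |x t| ≤ 2 * G) :
    ∃ i ∈ Finset.Icc 1 M,
      2 * Λ / (Real.exp (i : ℕ) * (4 * G / 3))⁻¹ +
        ∑ t ∈ Finset.Icc 1 T, ((Real.exp (i : ℕ) * (4 * G / 3))⁻¹ * x t ^ 2
          - (α * x t ^ 2) ^ (1 / β))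
      ≤ T * (8 * (Λ / (α * T)) ^ (1 / (2 - β)) + 8 * Λ * G / T) := by
  have hT' : (1 : ℝ) ≤ T := by exact_mod_cast hT
  have hT0 : (0 : ℝ) < T := by linarith
  set ε := (Λ / (α * T)) ^ (1 / (2 - β)) with hε_def
  have hq : 0 < Λ / (α * T) := by positivity
  have hε : 0 < ε := Real.rpow_pos_of_pos hq _
  have hεq : ε ^ (1 - β) * ε = Λ / (α * T) := by
    nth_rewrite 2 [← Real.rpow_one ε]
    rw [← Real.rpow_add hε, hε_def, ← Real.rpow_mul hq.le]
    have : 1 / (2 - β) * (1 - β + 1) = 1 := by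
      have : (2 - β) ≠ 0 := by linarith
      field_simp
      ring
    rw [this, Real.rpow_one]
  set h := α * ε ^ (1 - β) with hh_def
  have hh : 0 < h := by positivity
  have hhε : Λ / h = T * ε := by
    rw [div_eq_iff hh.ne', hh_def]
    have : T * ε * (α * ε ^ (1 - β)) = α * T * (ε ^ (1 - β) * ε) := by ring
    rw [this, hεq]
    field_simp
  have hsum : ∀ η, η ≤ h → ∑ t ∈ Finset.Icc 1 T, (η * x t ^ 2 - (α * x t ^ 2) ^ (1 / β))
      ≤ T * ε := by
    intro η hη
    calc _ ≤ ∑ t ∈ Finset.Icc 1 T, ε := by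
          refine Finset.sum_le_sum fun t _ => ?_
          have h1 := rpow_one_sub_mul_le hε.le (by positivity : 0 ≤ α * x t ^ 2) hβ hβ1
          have h2 : η * x t ^ 2 ≤ h * x t ^ 2 := by gcongr
          have h3 : h * x t ^ 2 = ε ^ (1 - β) * (α * x t ^ 2) := by rw [hh_def]; ring
          linarith
      _ = T * ε := by simp
  have hE : 0 < 4 * G / 3 := by linarith
  have hexp := Real.exp_one_lt_d9
  have hrhs : T * (8 * ε + 8 * Λ * G / T) = 8 * (T * ε) + 8 * (Λ * G) := by field_simp
  have hTε : 0 < T * ε := by positivity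
  have hΛG : 1 ≤ Λ * G := by nlinarith
  rw [hrhs]
  rcases exists_rate_near (h := h) hE hM with h1 | h1 | ⟨i, hi, h1, h2⟩
  · refine ⟨1, by simp [hM], ?_⟩
    have h2 := hsum _ h1
    have h3 : 2 * Λ / (Real.exp (1 : ℕ) * (4 * G / 3))⁻¹ = 8 / 3 * Real.exp 1 * (Λ * G) := by
      rw [div_inv_eq_mul]; push_cast; ring
    rw [h3]
    nlinarith
  · refine ⟨M, by simp [hM], ?_⟩
    have h2 : 2 * Λ / (Real.exp M * (4 * G / 3))⁻¹ ≤ 2 * (T * ε) := by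
      rw [← hhε, mul_div_assoc]
      gcongr
    have h3 : ∑ t ∈ Finset.Icc 1 T, ((Real.exp M * (4 * G / 3))⁻¹ * x t ^ 2
          - (α * x t ^ 2) ^ (1 / β)) ≤ 9 / 4 := by
      calc _ ≤ ∑ t ∈ Finset.Icc 1 T, (9 / 4) / (T : ℝ) := by
            refine Finset.sum_le_sum fun t ht => ?_
            rw [Finset.mem_Icc] at ht
            have h4 : x t ^ 2 ≤ 4 * G ^ 2 := by
              have := sq_le_sq' (abs_le.mp (hx t ht.1 ht.2)).1 (abs_le.mp (hx t ht.1 ht.2)).2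
              linarith
            have h5 : (0 : ℝ) ≤ (α * x t ^ 2) ^ (1 / β) := by positivity
            have h6 : (4 * G / 3) * (T : ℝ) ≤ Real.exp M := by
              refine le_trans ?_ hMT
              gcongr
              nlinarith
            have h7 : (Real.exp M * (4 * G / 3))⁻¹ * x t ^ 2
                ≤ ((4 * G / 3) * (T : ℝ) * (4 * G / 3))⁻¹ * (4 * G ^ 2) := by
              gcongr
            have h8 : ((4 * G / 3) * (T : ℝ) * (4 * G / 3))⁻¹ * (4 * G ^ 2) = (9 / 4) / (T : ℝ) := by
              field_simp
              norm_num
            linarith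
        _ = 9 / 4 := by
            simp only [Finset.sum_const, Nat.card_Icc, Nat.add_sub_cancel, nsmul_eq_mul]
            field_simp
    linarith
  · refine ⟨i, hi, ?_⟩
    have h3 := hsum _ h1
    have hη : 0 < (Real.exp (i : ℕ) * (4 * G / 3))⁻¹ := by positivity
    have h4 : 2 * Λ / (Real.exp (i : ℕ) * (4 * G / 3))⁻¹ ≤ 2 * Real.exp 1 * (T * ε) := by
      rw [← hhε, mul_div_assoc' _ Λ h, div_le_div_iff₀ hη hh]
      have : 2 * Λ * h ≤ 2 * Λ * (Real.exp 1 * (Real.exp (i : ℕ) * (4 * G / 3))⁻¹) := by gcongr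
      linarith
    nlinarith

theorem one_le_log_mul {G T : ℝ} (hG : 1 ≤ G) (hT : 0 < T)
    (h : Real.exp (Real.exp 1) ≤ (4 * G / 3) * T ^ 2) : 1 ≤ Real.log (G * T) := by
  have he := Real.exp_one_gt_d9
  have he' := Real.exp_one_lt_d9
  have h1 : Real.exp 1 ^ 2 * (4 / 3) ≤ Real.exp (Real.exp 1) := by
    have h2 : Real.exp (Real.exp 1) = Real.exp 1 ^ 2 * Real.exp (Real.exp 1 - 2) := by
      rw [← Real.exp_nat_mul, ← Real.exp_add]; ring_nf
    rw [h2]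
    gcongr
    have := Real.add_one_le_exp (Real.exp 1 - 2)
    linarith
  have h3 : Real.exp 1 ^ 2 ≤ (G * T) ^ 2 := by
    have : G * T ^ 2 ≤ (G * T) ^ 2 := by nlinarith [mul_nonneg (by linarith : 0 ≤ G) (sq_nonneg T)]
    nlinarith
  rw [Real.le_log_iff_exp_le (by positivity)]
  exact le_of_sq_le_sq h3 (by positivity)

theorem log_ceil_le {G T : ℝ} (hG : 1 ≤ G) (hT : 0 < T)
    (h : Real.exp (Real.exp 1) ≤ (4 * G / 3) * T ^ 2) :
    Real.log ⌈Real.log ((4 * G / 3) * T ^ 2)⌉₊ ≤ Real.log (Real.log (G * T)) + 2 := by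
  have hy := one_le_log_mul hG hT h
  set y := Real.log (G * T)
  have h1 : Real.log ((4 * G / 3) * T ^ 2) ≤ 2 * y + 1 := by
    have h2 : (4 * G / 3) * T ^ 2 ≤ Real.exp 1 * (G * T) ^ 2 := by
      have : G * T ^ 2 ≤ (G * T) ^ 2 := by
        nlinarith [mul_nonneg (by linarith : 0 ≤ G) (sq_nonneg T)]
      nlinarith [Real.exp_one_gt_d9, sq_nonneg (G * T)]
    refine (Real.log_le_log (by positivity) h2).trans (le_of_eq ?_)
    rw [Real.log_mul (by positivity) (by positivity), Real.log_exp, Real.log_pow]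
    push_cast
    ring
  have hpos : 0 < Real.log ((4 * G / 3) * T ^ 2) := by
    have := (Real.le_log_iff_exp_le (by positivity)).mpr h
    linarith [Real.exp_pos 1]
  have h3 := Nat.ceil_lt_add_one hpos.le
  have hM : (0 : ℝ) < ⌈Real.log ((4 * G / 3) * T ^ 2)⌉₊ := by exact_mod_cast Nat.ceil_pos.mpr hpos
  have h4 : (4 : ℝ) ≤ Real.exp 2 := by
    have : Real.exp 2 = Real.exp 1 ^ 2 := by rw [← Real.exp_nat_mul]; norm_num
    rw [this]
    nlinarith [Real.exp_one_gt_d9]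
  refine (Real.log_le_log hM (by nlinarith : _ ≤ y * Real.exp 2)).trans (le_of_eq ?_)
  rw [Real.log_mul (by positivity) (by positivity), Real.log_exp]

/-- Proposition 1 of the paper (deterministic form): near-optimal rate for Squint/BOA
run on a `(1/T²)`-cover of `B₁` in ℓ¹-norm, with uniform prior and `E = 4G/3`. -/
theorem fast_rate_discretization_BOA :
    ∃ C : ℝ, 0 < C ∧
      ∀ (d K T : ℕ), 1 ≤ d → 1 ≤ K → 1 ≤ T →
      ∀ (G : ℝ), 1 ≤ G → Real.exp (Real.exp 1) ≤ (4 * G / 3) * (T : ℝ) ^ 2 →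
      -- the grid Θ₀ = {θs 1, …, θs K} ⊂ B₁, enumerated injectively (so Card Θ₀ = K),
      -- which is a (1/T²)-cover of B₁ in ℓ¹-norm
      ∀ (θs : Fin K → Fin d → ℝ), Function.Injective θs → (∀ k, l1 (θs k) ≤ 1) →
      (∀ θ : Fin d → ℝ, l1 θ ≤ 1 → ∃ k, l1 (θ - θs k) ≤ 1 / (T : ℝ) ^ 2) →
      ∀ (ℓ : ℕ → (Fin d → ℝ) → ℝ) (α β : ℝ), 0 < α → 0 < β → β ≤ 1 →
      -- (A1): convex differentiable losses with gradients bounded by `G` in sup-norm on B₁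
      (∀ t, 1 ≤ t → t ≤ T → ConvexOn ℝ Set.univ (ℓ t)) →
      (∀ t, 1 ≤ t → t ≤ T → Differentiable ℝ (ℓ t)) →
      (∀ t, 1 ≤ t → t ≤ T → ∀ θ : Fin d → ℝ, l1 θ ≤ 1 → ∀ i, |grad (ℓ t) θ i| ≤ G) →
      -- (A2, deterministic form): weak exp-concavity
      (∀ t, 1 ≤ t → t ≤ T → ∀ θ θ' : Fin d → ℝ, l1 θ ≤ 1 → l1 θ' ≤ 1 →
        ℓ t θ - ℓ t θ' ≤ dotp (grad (ℓ t) θ) (θ - θ')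
          - (α * (dotp (grad (ℓ t) θ) (θ - θ')) ^ 2) ^ ((1 : ℝ) / β)) →
      -- the algorithm with uniform prior and E = 4G/3
      ∀ (θh : ℕ → Fin d → ℝ) (πh : ℕ → Fin K → ℝ) (r : ℕ → Fin K → ℝ),
      (∀ t k, r t k = dotp (grad (ℓ t) (θh (t - 1))) (θh (t - 1) - θs k)) →
      (∀ k, πh 0 k = 1 / (K : ℝ)) →
      (∀ t, 1 ≤ t → t ≤ T → ∀ k,
        πh t k = boaWeight (4 * G / 3) ⌈Real.log ((4 * G / 3) * (T : ℝ) ^ 2)⌉₊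
          (fun _ => 1 / (K : ℝ)) r t k) →
      (∀ t, t ≤ T → θh t = ∑ k, πh t k • θs k) →
      -- conclusion: for every θ in B₁
      ∀ θ : Fin d → ℝ, l1 θ ≤ 1 →
        (1 / (T : ℝ)) * ∑ t ∈ Finset.Icc 1 T, (ℓ t (θh (t - 1)) - ℓ t θ)
          ≤ C * (((Real.log K + Real.log (Real.log (G * T)) + 1) / (α * T))
              ^ ((1 : ℝ) / (2 - β)))
            + C * (Real.log K + Real.log (Real.log (G * T)) + 1) * G / T
            + G / (T : ℝ) ^ 2 := by
  refine ⟨8, by norm_num, ?_⟩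
  intro d K T _ hK hT G hG hGT θs _ hθs hcover ℓ α β hα hβ hβ1 _ _ hgrad hexpc θh πh r hr hπ0 hπ
    hθh θ hθ
  have hT0 : (0 : ℝ) < T := by exact_mod_cast hT
  set M := ⌈Real.log ((4 * G / 3) * (T : ℝ) ^ 2)⌉₊ with hM_def
  have hlogpos : 0 < Real.log ((4 * G / 3) * (T : ℝ) ^ 2) := by
    have := (Real.le_log_iff_exp_le (by positivity)).mpr hGT
    linarith [Real.exp_pos 1]
  have hM : 1 ≤ M := Nat.ceil_pos.mpr hlogpos
  have hMT : (4 * G / 3) * (T : ℝ) ^ 2 ≤ Real.exp M := by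
    rw [← Real.log_le_iff_le_exp (by positivity)]
    exact Nat.le_ceil _
  have hE : 0 < 4 * G / 3 := by linarith
  let η : ℕ → ℝ := fun i => (Real.exp i * (4 * G / 3))⁻¹
  have hη : ∀ i, 0 < η i := fun i => by positivity
  let w : ℕ → Fin K → ℝ := fun t k => ∑ i ∈ Finset.Icc 1 M, η i *
    Real.exp (η i * ∑ s ∈ Finset.Icc 1 t, (r s k - η i * (r s k) ^ 2))
  have hw : ∀ t k, 0 < w t k := fun t k =>
    Finset.sum_pos (fun i _ => mul_pos (hη i) (Real.exp_pos _)) ⟨1, by simp [hM]⟩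
  have hKne : (Finset.univ : Finset (Fin K)).Nonempty := ⟨⟨0, hK⟩, Finset.mem_univ _⟩
  have hW : ∀ t, 0 < ∑ j, w t j := fun t => Finset.sum_pos (fun j _ => hw t j) hKne
  have hπw : ∀ t, t ≤ T → ∀ k, πh t k = w t k / ∑ j, w t j := by
    intro t ht k
    rcases Nat.eq_zero_or_pos t with rfl | h0
    · have h1 : ∀ j, w 0 j = ∑ i ∈ Finset.Icc 1 M, η i := fun j => by simp [w]
      have h2 : (∑ i ∈ Finset.Icc 1 M, η i) ≠ 0 := by rw [← h1 k]; exact (hw 0 k).ne'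
      rw [hπ0]
      simp only [h1, Finset.sum_const, Finset.card_univ, Fintype.card_fin, nsmul_eq_mul]
      field_simp
    · rw [hπ t h0 ht k, boaWeight_uniform hK]
  have hπnn : ∀ t, t ≤ T → ∀ k, 0 ≤ πh t k := fun t ht k => by
    rw [hπw t ht k]; exact (div_pos (hw t k) (hW t)).le
  have hπs : ∀ t, t ≤ T → ∑ k, πh t k = 1 := fun t ht => by
    simp only [hπw t ht]
    rw [← Finset.sum_div, div_self (hW t).ne']
  have hθB : ∀ t, t ≤ T → l1 (θh t) ≤ 1 := fun t ht => by
    rw [hθh t ht]; exact l1_sum_smul_le_one (hπnn t ht) (hπs t ht) hθs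
  have hrb : ∀ t, 1 ≤ t → t ≤ T → ∀ k, |r t k| ≤ 2 * G := fun t h1 h2 k => by
    have hB := hθB (t - 1) (by omega)
    rw [hr]
    refine (abs_dotp_le (hgrad t h1 h2 _ hB) _).trans ?_
    have := l1_sub_le (θh (t - 1)) (θs k)
    nlinarith [hθs k]
  have hlow : ∀ t, 1 ≤ t → t ≤ T → ∀ i ∈ Finset.Icc 1 M, ∀ k, -(14 / 25) ≤ η i * r t k := by
    intro t h1 h2 i hi k
    have h3 := (abs_le.mp (hrb t h1 h2 k)).1
    have h4 : η i * (2 * G) ≤ 14 / 25 := by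
      have hi1 : (1 : ℝ) ≤ i := by exact_mod_cast (Finset.mem_Icc.mp hi).1
      have h5 : Real.exp 1 ≤ Real.exp i := Real.exp_le_exp.mpr hi1
      have h6 := Real.exp_one_gt_d9
      change (Real.exp i * (4 * G / 3))⁻¹ * (2 * G) ≤ 14 / 25
      rw [inv_mul_le_iff₀ (by positivity)]
      nlinarith
    nlinarith [hη i]
  have hzero : ∀ t, t < T → ∑ k, w t k * r (t + 1) k = 0 := by
    intro t ht
    have h1 := sum_mul_dotp_sub_eq_zero (hπs t ht.le) (grad (ℓ (t + 1)) (θh t)) θs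
    rw [← hθh t ht.le] at h1
    have h2 : ∀ k, w t k * r (t + 1) k = (∑ j, w t j) *
        (πh t k * dotp (grad (ℓ (t + 1)) (θh t)) (θh t - θs k)) := fun k => by
      rw [hπw t ht.le, hr, Nat.add_sub_cancel]
      field_simp [(hW t).ne']
    simp only [h2]
    rw [← Finset.mul_sum, h1, mul_zero]
  obtain ⟨k, hk⟩ := hcover θ hθ
  have hy := one_le_log_mul hG hT0 hGT
  have hly : 0 ≤ Real.log (Real.log (G * T)) := Real.log_nonneg hy
  have hlK : 0 ≤ Real.log K := Real.log_nonneg (by exact_mod_cast hK)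
  have hlM := log_ceil_le hG hT0 hGT
  rw [← hM_def] at hlM
  set Λ := Real.log K + Real.log (Real.log (G * T)) + 1 with hΛ_def
  obtain ⟨i, hi, htrade⟩ := exists_rate_tradeoff_le hT hM hG hα hβ hβ1
    (by linarith : 1 ≤ Λ) hMT (fun t => r t k) (fun t h1 h2 => hrb t h1 h2 k)
  have hreg := squint_regret_le M η r T hlow hzero i hi k
  have hreg' : ∑ s ∈ Finset.Icc 1 T, (r s k - η i * (r s k) ^ 2) ≤ 2 * Λ / η i := by
    rw [le_div_iff₀ (hη i), mul_comm]
    linarith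
  have hloss : ∀ t ∈ Finset.Icc 1 T, ℓ t (θh (t - 1)) - ℓ t θ
      ≤ (r t k - η i * (r t k) ^ 2) + (η i * (r t k) ^ 2 - (α * (r t k) ^ 2) ^ (1 / β))
        + G / (T : ℝ) ^ 2 := by
    intro t ht
    rw [Finset.mem_Icc] at ht
    have h1 := hexpc t ht.1 ht.2 _ _ (hθB (t - 1) (by omega)) (hθs k)
    rw [← hr t k] at h1
    have h2 := hexpc t ht.1 ht.2 _ _ (hθs k) hθ
    have h3 : 0 ≤ (α * (dotp (grad (ℓ t) (θs k)) (θs k - θ)) ^ 2) ^ (1 / β) := by positivity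
    have h4 := (le_abs_self _).trans
      (abs_dotp_le (hgrad t ht.1 ht.2 _ (hθs k)) (θs k - θ))
    rw [l1_sub_comm] at h4
    have h5 : G * l1 (θ - θs k) ≤ G / (T : ℝ) ^ 2 := by
      rw [div_eq_mul_one_div]
      gcongr
    linarith
  have hsum := Finset.sum_le_sum hloss
  rw [Finset.sum_add_distrib, Finset.sum_add_distrib] at hsum
  simp only [Finset.sum_const, Nat.card_Icc, Nat.add_sub_cancel, nsmul_eq_mul] at hsum
  rw [one_div_mul_eq_div, div_le_iff₀' hT0]
  change 2 * Λ / η i + ∑ t ∈ Finset.Icc 1 T, (η i * r t k ^ 2 - (α * r t k ^ 2) ^ (1 / β))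
    ≤ _ at htrade
  linarith
end

section
/- Let ε ≥ 0, let d₀ be a positive integer, and let θ, θ' ∈ B₁ with θ ≠ 0, ‖θ − θ'‖_∞ ≤ ε and ‖θ‖₀ ≤ d₀. Define the dilated soft-threshold θ̃ := S_ε(θ') · min{1 + 2 d₀ ε / ‖S_ε(θ')‖₁, 1/‖S_ε(θ')‖₁} (with the convention θ̃ := 0 when S_ε(θ') = 0). Then: (i) ‖θ̃‖₁ ≥ ‖θ‖₁ whenever θ̃ ≠ 0; (ii) sign(θ̃_i) ∈ {0, sign(θ_i)} for all 1 ≤ i ≤ d; (iii) D(θ, θ̃) ≤ 2 d₀ ε / ‖θ‖₁. -/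
open Finset

/-- sup (ℓ∞) norm on `Fin d → ℝ`. -/
noncomputable def linf {d : ℕ} (x : Fin d → ℝ) : ℝ := ⨆ i, |x i|

/-- ℓ⁰ "norm": number of nonzero coordinates. -/
noncomputable def l0 {d : ℕ} (x : Fin d → ℝ) : ℕ :=
  (Finset.univ.filter fun i => x i ≠ 0).card

/-- Averaging accelerability `D(θ, θ')`. -/
noncomputable def Dacc {d : ℕ} (θ θ' : Fin d → ℝ) : ℝ :=
  sInf {p : ℝ | p ∈ Set.Icc (0 : ℝ) 1 ∧ l1 (θ - (1 - p) • θ') ≤ p}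

/-- Soft-threshold operator. -/
noncomputable def softThresh {d : ℕ} (ε : ℝ) (x : Fin d → ℝ) : Fin d → ℝ :=
  fun i => Real.sign (x i) * max (|x i| - ε) 0

theorem l1_nonneg {d : ℕ} (x : Fin d → ℝ) : 0 ≤ l1 x :=
  Finset.sum_nonneg fun _ _ => abs_nonneg _

theorem l1_eq_zero_iff {d : ℕ} {x : Fin d → ℝ} : l1 x = 0 ↔ x = 0 := by
  simp [l1, Finset.sum_eq_zero_iff_of_nonneg, funext_iff]

theorem l1_pos {d : ℕ} {x : Fin d → ℝ} (hx : x ≠ 0) : 0 < l1 x :=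
  lt_of_le_of_ne (l1_nonneg x) fun h => hx (l1_eq_zero_iff.1 h.symm)

theorem l1_smul {d : ℕ} (c : ℝ) (x : Fin d → ℝ) : l1 (c • x) = |c| * l1 x := by
  simp [l1, abs_mul, Finset.mul_sum]

theorem Real.sign_mul_of_pos_left {c : ℝ} (hc : 0 < c) (x : ℝ) :
    Real.sign (c * x) = Real.sign x := by
  rcases lt_trichotomy x 0 with h | rfl | h
  · rw [Real.sign_of_neg h, Real.sign_of_neg (mul_neg_of_pos_of_neg hc h)]
  · rw [mul_zero]
  · rw [Real.sign_of_pos h, Real.sign_of_pos (mul_pos hc h)]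

theorem abs_le_linf {d : ℕ} (x : Fin d → ℝ) (i : Fin d) : |x i| ≤ linf x :=
  le_ciSup (f := fun i => |x i|) (Set.finite_range _).bddAbove i

theorem Dacc_le {d : ℕ} {θ θ' : Fin d → ℝ} {p : ℝ} (h0 : 0 ≤ p) (h1 : p ≤ 1)
    (h : l1 (θ - (1 - p) • θ') ≤ p) : Dacc θ θ' ≤ p :=
  csInf_le ⟨0, fun _ hq => hq.1.1⟩ ⟨⟨h0, h1⟩, h⟩

/-- Scalar soft-thresholding of an `ε`-approximation `b` of `a` shrinks `a` towards zero. -/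
theorem sign_mul_max_shrinks {ε a b : ℝ} (hab : |a - b| ≤ ε) :
    |a - Real.sign b * max (|b| - ε) 0| = |a| - |Real.sign b * max (|b| - ε) 0| ∧
    |a| - |Real.sign b * max (|b| - ε) 0| ≤ 2 * ε ∧
    (Real.sign b * max (|b| - ε) 0 = 0 ∨
      Real.sign (Real.sign b * max (|b| - ε) 0) = Real.sign a) := by
  obtain ⟨h1, h2⟩ := abs_le.1 hab
  rcases le_or_gt |b| ε with hb | hb
  · rw [max_eq_right (by linarith)]
    have := abs_sub_abs_le_abs_sub a b
    refine ⟨by simp, ?_, by simp⟩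
    simp only [mul_zero, abs_zero]
    linarith
  · rw [max_eq_left (by linarith)]
    have hε : 0 ≤ ε := (abs_nonneg _).trans hab
    rcases lt_trichotomy b 0 with h | h | h
    · rw [abs_of_neg h] at hb
      have ha : a < 0 := by linarith
      rw [Real.sign_of_neg h, abs_of_neg h, Real.sign_of_neg ha, abs_of_neg ha,
        abs_of_nonpos (by linarith), abs_of_neg (by linarith : -1 * (-b - ε) < 0)]
      exact ⟨by ring, by linarith, Or.inr (Real.sign_of_neg (by linarith))⟩
    · rw [h, abs_zero] at hb
      linarith
    · rw [abs_of_pos h] at hb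
      have ha : 0 < a := by linarith
      rw [Real.sign_of_pos h, abs_of_pos h, Real.sign_of_pos ha, abs_of_pos ha,
        abs_of_nonneg (by linarith), abs_of_pos (by linarith : 0 < 1 * (b - ε))]
      exact ⟨by ring, by linarith, Or.inr (Real.sign_of_pos (by linarith))⟩

theorem sign_softThresh {d : ℕ} {ε : ℝ} {θ θ' : Fin d → ℝ} (h : linf (θ - θ') ≤ ε) (i : Fin d) :
    softThresh ε θ' i = 0 ∨ Real.sign (softThresh ε θ' i) = Real.sign (θ i) :=
  (sign_mul_max_shrinks ((abs_le_linf (θ - θ') i).trans h)).2.2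

theorem l1_sub_softThresh {d : ℕ} {ε : ℝ} {θ θ' : Fin d → ℝ} (h : linf (θ - θ') ≤ ε) :
    l1 (θ - softThresh ε θ') = l1 θ - l1 (softThresh ε θ') := by
  simp only [l1, ← Finset.sum_sub_distrib]
  exact Finset.sum_congr rfl fun i _ =>
    (sign_mul_max_shrinks ((abs_le_linf (θ - θ') i).trans h)).1

theorem l1_sub_l1_softThresh_le {d : ℕ} {ε : ℝ} {θ θ' : Fin d → ℝ} (h : linf (θ - θ') ≤ ε) :
    l1 θ - l1 (softThresh ε θ') ≤ l0 θ * (2 * ε) := by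
  simp only [l1, l0, ← Finset.sum_sub_distrib]
  rw [← nsmul_eq_mul, ← Finset.sum_const, Finset.sum_filter]
  refine Finset.sum_le_sum fun i _ => ?_
  split_ifs with hi
  · exact (sign_mul_max_shrinks ((abs_le_linf (θ - θ') i).trans h)).2.1
  · simp [not_not.1 hi]

/-- Lemma 3 of the paper: properties of the dilated soft-threshold. -/
theorem dilated_softThresh_properties {d : ℕ} (ε : ℝ) (hε : 0 ≤ ε) (d0 : ℕ) (hd0 : 0 < d0)
    (θ θ' : Fin d → ℝ) (hθ : l1 θ ≤ 1) (hθ' : l1 θ' ≤ 1) (hθne : θ ≠ 0)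
    (happrox : linf (θ - θ') ≤ ε) (hsparse : l0 θ ≤ d0)
    (θt : Fin d → ℝ)
    (hθt : θt = if softThresh ε θ' = 0 then 0 else
      (min (1 + 2 * (d0 : ℝ) * ε / l1 (softThresh ε θ')) (l1 (softThresh ε θ'))⁻¹) •
        softThresh ε θ') :
    (θt ≠ 0 → l1 θ ≤ l1 θt) ∧
    (∀ i, Real.sign (θt i) = 0 ∨ Real.sign (θt i) = Real.sign (θ i)) ∧
    Dacc θ θt ≤ 2 * (d0 : ℝ) * ε / l1 θ := by
  set s := softThresh ε θ' with hs
  set k := 2 * (d0 : ℝ) * ε with hk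
  have hk0 : 0 ≤ k := by positivity
  have hT : 0 < l1 θ := l1_pos hθne
  have hsub : l1 (θ - s) = l1 θ - l1 s := l1_sub_softThresh happrox
  have hTs : l1 θ - l1 s ≤ k := by
    have hcast : (l0 θ : ℝ) ≤ d0 := by exact_mod_cast hsparse
    have := mul_le_mul_of_nonneg_right hcast (by positivity : 0 ≤ 2 * ε)
    have := l1_sub_l1_softThresh_le happrox
    linarith
  have hsT : l1 s ≤ l1 θ := by linarith [l1_nonneg (θ - s)]
  by_cases hs0 : s = 0
  · rw [if_pos hs0] at hθt
    refine ⟨fun h => absurd hθt h, fun i => Or.inl (by simp [hθt]), ?_⟩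
    rw [l1_eq_zero_iff.2 hs0, sub_zero] at hTs
    exact (Dacc_le zero_le_one le_rfl (by simpa using hθ)).trans ((one_le_div hT).2 hTs)
  rw [if_neg hs0] at hθt
  have hS : 0 < l1 s := l1_pos hs0
  set c := min (1 + k / l1 s) (l1 s)⁻¹ with hc
  have hc1 : 1 ≤ c :=
    le_min (le_add_of_nonneg_right (by positivity)) ((one_le_inv₀ hS).2 (hsT.trans hθ))
  have hc0 : 0 < c := by linarith
  have ht : l1 θt = min (l1 s + k) 1 := by
    rw [hθt, l1_smul, abs_of_pos hc0, hc, min_mul_of_nonneg _ _ hS.le]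
    congr 1 <;> field_simp
  have hTt : l1 θ ≤ l1 θt := ht ▸ le_min (by linarith) hθ
  refine ⟨fun _ => hTt, fun i => ?_, ?_⟩
  · have hi : θt i = c * s i := by simp [hθt]
    rcases sign_softThresh happrox i with h | h
    · left
      rw [hi, hs, h]
      simp
    · right
      rw [hi, ← h, Real.sign_mul_of_pos_left hc0]
  · have hct : c * l1 s = l1 θt := by rw [hθt, l1_smul, abs_of_pos hc0]
    have ht0 : 0 < l1 θt := hT.trans_le hTt
    have ht1 : l1 θt ≤ 1 := ht ▸ min_le_right _ _
    have htk : l1 θt ≤ l1 s + k := ht ▸ min_le_left _ _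
    have hp : 1 - c⁻¹ = (l1 θt - l1 s) / l1 θt := by
      rw [← hct]
      field_simp
    have hback : (1 - (1 - c⁻¹)) • θt = s := by
      rw [sub_sub_cancel, hθt, inv_smul_smul₀ hc0.ne']
    refine (Dacc_le (p := 1 - c⁻¹) (sub_nonneg.2 (inv_le_one_of_one_le₀ hc1))
      (sub_le_self _ (by positivity)) ?_).trans ?_
    · rw [hback, hsub, hp]
      exact (by linarith : l1 θ - l1 s ≤ l1 θt - l1 s).trans
        (le_div_self (by linarith) ht0 ht1)
    · rw [hp]
      exact div_le_div₀ hk0 (by linarith) hT hTt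
end
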